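/- Let F be a γ-pliable set family on a finite set V, let I be an inclusion-minimal cover of F such that every edge of I covers some F-core, let U be the union of all F-cores, let L be a laminar witness family for I augmented with V, let (S₀, S₁, …, S_ℓ) be a hollow chain in L with ℓ ≥ 1, and for each i let a_i b_i be the unique edge of I covering S_i with a_i ∈ S_i. If a₁ ∈ U, then ℓ = 1. -/

import Mathlib

open scoped Classical

namespace SFEC

variable {V : Type*}

/-- An edge (an unordered pair of distinct elements) `e` covers a set `S`
if exactly one endpoint of `e` lies in `S`. -/
def Covers (e : Sym2 V) (S : Set V) : Prop :=
  ∃ u v : V, e = s(u, v) ∧ u ∈ S ∧ v ∉ S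

/-- `delta I S` is the set of edges of `I` with exactly one endpoint in `S`. -/
noncomputable def delta (I : Finset (Sym2 V)) (S : Set V) : Finset (Sym2 V) :=
  I.filter (fun e => Covers e S)

/-- `d I S = |delta I S|`. -/
noncomputable def d (I : Finset (Sym2 V)) (S : Set V) : ℕ := (delta I S).card

/-- A set family on `V`: a collection of subsets with `∅ ∉ F` and `V ∉ F`. -/
def IsSetFamily (F : Set (Set V)) : Prop := ∅ ∉ F ∧ Set.univ ∉ F

/-- `I` covers the family `F` if it covers every member of `F`. -/
def CoversFam (I : Finset (Sym2 V)) (F : Set (Set V)) : Prop := ∀ S ∈ F, 1 ≤ d I S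

/-- `I` is an inclusion-minimal cover of `F`. -/
def MinimalCover (I : Finset (Sym2 V)) (F : Set (Set V)) : Prop :=
  CoversFam I F ∧ ∀ J : Finset (Sym2 V), J ⊂ I → ¬ CoversFam J F

/-- At least two of the four statements hold. -/
def AtLeastTwo (p q r s : Prop) : Prop :=
  (p ∧ q) ∨ (p ∧ r) ∨ (p ∧ s) ∨ (q ∧ r) ∨ (q ∧ s) ∨ (r ∧ s)

/-- A family is pliable if for all `A, B ∈ F` at least two of the four sets
`A ∩ B, A ∪ B, A \ B, B \ A` belong to `F`. -/
def Pliable (F : Set (Set V)) : Prop :=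
  ∀ A ∈ F, ∀ B ∈ F, AtLeastTwo (A ∩ B ∈ F) (A ∪ B ∈ F) (A \ B ∈ F) (B \ A ∈ F)

/-- The residual family `F^I`: the members of `F` covered by no edge of `I`. -/
def Residual (F : Set (Set V)) (I : Finset (Sym2 V)) : Set (Set V) := {S ∈ F | d I S = 0}

/-- `A` and `B` cross if `A ∩ B`, `A \ B`, `B \ A` and `V \ (A ∪ B)` are all nonempty. -/
def Crosses (A B : Set V) : Prop :=
  (A ∩ B).Nonempty ∧ (A \ B).Nonempty ∧ (B \ A).Nonempty ∧ ((A ∪ B)ᶜ : Set V).Nonempty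

/-- An `F`-core: an inclusion-minimal member of `F`. -/
def Core (F : Set (Set V)) (C : Set V) : Prop := C ∈ F ∧ ∀ A ∈ F, A ⊆ C → A = C

/-- Property (γ). -/
def PropertyGamma (F : Set (Set V)) : Prop :=
  ∀ (J : Finset (Sym2 V)) (S₁ S₂ C : Set V),
    S₁ ∈ Residual F J → S₂ ∈ Residual F J → S₁ ⊂ S₂ →
    Core (Residual F J) C → Crosses C S₁ → Crosses C S₂ →
    S₂ \ (S₁ ∪ C) = ∅ ∨ S₂ \ (S₁ ∪ C) ∈ Residual F J

/-- `F` is γ-pliable: pliable and satisfying Property (γ). -/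
def GammaPliable (F : Set (Set V)) : Prop := Pliable F ∧ PropertyGamma F

/-- `S` is a witness set for the edge `e ∈ I` if `δ_I(S) = {e}`. -/
def WitnessSet (F : Set (Set V)) (I : Finset (Sym2 V)) (S : Set V) (e : Sym2 V) : Prop :=
  S ∈ F ∧ delta I S = {e}

/-- `L ⊆ F` is a witness family for `I`: `|L| = |I|` and each `e ∈ I` has a witness set in `L`. -/
def WitnessFamily (F : Set (Set V)) (I : Finset (Sym2 V)) (L : Finset (Set V)) : Prop :=
  ↑L ⊆ F ∧ L.card = I.card ∧ ∀ e ∈ I, ∃ S ∈ L, WitnessSet F I S e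

/-- A family is laminar if any two members are disjoint or one contains the other. -/
def Laminar (L : Finset (Set V)) : Prop :=
  ∀ A ∈ L, ∀ B ∈ L, A ⊆ B ∨ B ⊆ A ∨ Disjoint A B

/-- `S ∈ L` owns `C` if `S` is the inclusion-minimal member of `L` containing `C`. -/
def Owns (L : Finset (Set V)) (S C : Set V) : Prop :=
  S ∈ L ∧ C ⊆ S ∧ ∀ T ∈ L, C ⊆ T → S ⊆ T

/-- `S ∈ L` is hollow if it owns no `F`-core. -/
def Hollow (F : Set (Set V)) (L : Finset (Set V)) (S : Set V) : Prop :=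
  S ∈ L ∧ ∀ C : Set V, Core F C → ¬ Owns L S C

/-- `A` is the unique child of `S` in `L`: the unique maximal member of `L`
properly contained in `S`. -/
def UniqueChild (L : Finset (Set V)) (A S : Set V) : Prop :=
  A ∈ L ∧ A ⊂ S ∧ ∀ B ∈ L, B ⊂ S → B ⊆ A

/-- `(S 0, S 1, …, S ℓ)` is a hollow chain in `L`. -/
def HollowChain (F : Set (Set V)) (L : Finset (Set V)) (S : ℕ → Set V) (ℓ : ℕ) : Prop :=
  (∀ i ≤ ℓ, S i ∈ L) ∧
  (∀ i, 1 ≤ i → i ≤ ℓ → Hollow F L (S i)) ∧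
  S ℓ ≠ Set.univ ∧
  (∀ i, 1 ≤ i → i ≤ ℓ → UniqueChild L (S (i - 1)) (S i))

/-- `U`: the union of all `F`-cores. -/
def coreUnion (F : Set (Set V)) : Set V := ⋃₀ {C | Core F C}

/-- `F` is uncrossable. -/
def Uncrossable (F : Set (Set V)) : Prop :=
  ∀ A ∈ F, ∀ B ∈ F, (A ∩ B ∈ F ∧ A ∪ B ∈ F) ∨ (A \ B ∈ F ∧ B \ A ∈ F)

/-- `F` is semi-uncrossable. -/
def SemiUncrossable (F : Set (Set V)) : Prop :=
  ∀ A ∈ F, ∀ B ∈ F,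
    (A ∩ B ∈ F ∧ (A ∪ B ∈ F ∨ A \ B ∈ F ∨ B \ A ∈ F)) ∨ (A \ B ∈ F ∧ B \ A ∈ F)

end SFEC

open SFEC

namespace SFEC

theorem residual_empty {V : Type*} (F : Set (Set V)) : Residual F ∅ = F := by
  simp [Residual, d, delta]

theorem exists_core_subset {V : Type*} [Finite V] {F : Set (Set V)} {A : Set V} (hA : A ∈ F) :
    ∃ C, Core F C ∧ C ⊆ A := by
  obtain ⟨C, hCA, hC⟩ := (Set.toFinite F).exists_le_minimal hA
  exact ⟨C, ⟨hC.prop, fun B hB hBC => hC.eq_of_le hB hBC⟩, hCA⟩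

/-- In a pliable family a core that meets a member without being contained in it crosses it. -/
theorem Core.crosses {V : Type*} {F : Set (Set V)} (hF : IsSetFamily F) (hp : Pliable F)
    {C S : Set V} (hC : Core F C) (hS : S ∈ F) (hne : (C ∩ S).Nonempty) (hnot : ¬ C ⊆ S) :
    Crosses C S := by
  have h₁ : C ∩ S ∉ F := fun h => hnot (Set.inter_eq_left.mp (hC.2 _ h Set.inter_subset_left))
  have h₂ : C \ S ∉ F := fun h => by
    obtain ⟨x, hxC, hxS⟩ := hne
    rw [← hC.2 _ h Set.sdiff_subset] at hxC
    exact hxC.2 hxS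
  have h₃ : C ∪ S ∈ F ∧ S \ C ∈ F := by
    have := hp C hC.1 S hS
    unfold AtLeastTwo at this
    tauto
  refine ⟨hne, Set.sdiff_nonempty.mpr hnot, ?_, ?_⟩
  · exact Set.nonempty_iff_ne_empty.mpr fun h => hF.1 (h ▸ h₃.2)
  · exact Set.nonempty_compl.mpr fun h => hF.2 (h ▸ h₃.1)

/-- Distinct cores of a pliable family are disjoint. -/
theorem Core.eq_of_mem {V : Type*} {F : Set (Set V)} (hp : Pliable F)
    {C D : Set V} (hC : Core F C) (hD : Core F D) {x : V} (hxC : x ∈ C) (hxD : x ∈ D) :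
    C = D := by
  have hCD : D \ C ∉ F := fun h => by
    rw [← hD.2 _ h Set.sdiff_subset] at hxD
    exact hxD.2 hxC
  by_contra hne
  have hnot : ¬ C ⊆ D := fun h => hne (hD.2 _ hC.1 h)
  have h₁ : C ∩ D ∉ F := fun h => hnot (Set.inter_eq_left.mp (hC.2 _ h Set.inter_subset_left))
  have h₂ : C \ D ∉ F := fun h => by
    rw [← hC.2 _ h Set.sdiff_subset] at hxC
    exact hxC.2 hxD
  have := hp C hC.1 D hD.1
  unfold AtLeastTwo at this
  tauto

theorem Laminar.insert_univ {V : Type*} {L : Finset (Set V)} (h : Laminar L) :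
    Laminar (insert Set.univ L) := by
  intro A hA B hB
  rcases Finset.mem_insert.mp hA with rfl | hA
  · exact Or.inr (Or.inl (Set.subset_univ _))
  rcases Finset.mem_insert.mp hB with rfl | hB
  · exact Or.inl (Set.subset_univ _)
  exact h A hA B hB

theorem Laminar.exists_owns {V : Type*} {L : Finset (Set V)} (hL : Laminar L)
    {C S : Set V} (hC : C.Nonempty) (hS : S ∈ L) (hCS : C ⊆ S) :
    ∃ T, Owns L T C ∧ T ⊆ S := by
  obtain ⟨T, -, hT⟩ := (L.finite_toSet.subset (Set.sep_subset _ (fun T => C ⊆ T))).exists_le_minimal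
    (show S ∈ {T ∈ (L : Set (Set V)) | C ⊆ T} from ⟨hS, hCS⟩)
  have key : ∀ R ∈ L, C ⊆ R → T ⊆ R := by
    intro R hR hCR
    rcases hL T hT.prop.1 R hR with h | h | h
    · exact h
    · exact (hT.eq_of_le ⟨hR, hCR⟩ h).ge
    · obtain ⟨x, hx⟩ := hC
      exact (Set.disjoint_left.mp h (hT.prop.2 hx) (hCR hx)).elim
  exact ⟨T, ⟨hT.prop.1, hT.prop.2, key⟩, key S hS hCS⟩

/-- A core inside a hollow set lies inside the unique child of that set. -/
theorem Core.subset_of_uniqueChild {V : Type*} {F : Set (Set V)} (hF : IsSetFamily F)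
    {L : Finset (Set V)} (hL : Laminar L) {A S C : Set V} (hS : Hollow F L S)
    (hA : UniqueChild L A S) (hC : Core F C) (hCS : C ⊆ S) : C ⊆ A := by
  have hne : C.Nonempty := Set.nonempty_iff_ne_empty.mpr fun h => hF.1 (h ▸ hC.1)
  obtain ⟨T, hT, hTS⟩ := hL.exists_owns hne hS.1 hCS
  have hTne : T ≠ S := fun h => hS.2 C hC (h ▸ hT)
  exact hT.2.1.trans (hA.2.2 T hT.1 (hTS.ssubset_of_ne hTne))

/-- Distinct members of a witness family are witnesses for distinct edges. -/
theorem WitnessFamily.injOn_delta {V : Type*} {F : Set (Set V)} {I : Finset (Sym2 V)}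
    {L : Finset (Set V)} (h : WitnessFamily F I L) : Set.InjOn (delta I) (L : Set (Set V)) := by
  have hsub : I.image (fun e => ({e} : Finset (Sym2 V))) ⊆ L.image (delta I) := by
    intro x hx
    obtain ⟨e, he, rfl⟩ := Finset.mem_image.mp hx
    obtain ⟨S, hS, hw⟩ := h.2.2 e he
    exact Finset.mem_image.mpr ⟨S, hS, hw.2⟩
  have hcard := Finset.card_le_card hsub
  rw [Finset.card_image_of_injective _ Finset.singleton_injective, ← h.2.1] at hcard
  exact Finset.card_image_iff.mp (le_antisymm Finset.card_image_le hcard)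

/-- An edge of `I` covering a set with `delta I S = {f}` is `f`. -/
theorem eq_of_delta_eq_singleton {V : Type*} {I : Finset (Sym2 V)} {S : Set V} {f : Sym2 V}
    (h : delta I S = {f}) {u v : V} (he : s(u, v) ∈ I) (hu : u ∈ S) (hv : v ∉ S) :
    s(u, v) = f := by
  rw [← Finset.mem_singleton, ← h]
  exact Finset.mem_filter.mpr ⟨he, u, v, rfl, hu, hv⟩

end SFEC

theorem stmt_12
    {V : Type*} [Fintype V]
    (F : Set (Set V)) (hF : IsSetFamily F) (hgp : GammaPliable F)
    (I : Finset (Sym2 V)) (hIe : ∀ e ∈ I, ¬ e.IsDiag)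
    (hmin : MinimalCover I F)
    (hcov : ∀ e ∈ I, ∃ C : Set V, Core F C ∧ Covers e C)
    (L : Finset (Set V)) (hWF : WitnessFamily F I L) (hlam : Laminar L)
    (S : ℕ → Set V) (ℓ : ℕ)
    (hchain : HollowChain F (insert Set.univ L) S ℓ)
    (a b : ℕ → V)
    (hedge : ∀ i ≤ ℓ, s(a i, b i) ∈ I ∧ a i ∈ S i ∧ b i ∉ S i ∧
      delta I (S i) = {s(a i, b i)})
    (hℓ : 1 ≤ ℓ) (haU : a 1 ∈ coreUnion F) :
    ℓ = 1 := by
  by_contra hℓ1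
  have hℓ2 : 2 ≤ ℓ := by omega
  obtain ⟨hSL, hhol, -, huc⟩ := hchain
  obtain ⟨hp, hγ⟩ := hgp
  have hlam' := hlam.insert_univ
  have h01 := huc 1 le_rfl hℓ
  have h12 := huc 2 (by norm_num) hℓ2
  have hS1 := hhol 1 le_rfl hℓ
  have hS2 := hhol 2 (by norm_num) hℓ2
  simp only [Nat.sub_self, Nat.add_one_sub_one] at h01 h12
  have hmem : ∀ i ≤ ℓ, S i ∈ L := fun i hi =>
    (Finset.mem_insert.mp (hSL i hi)).resolve_left fun h => (hedge i hi).2.2.1 (h ▸ Set.mem_univ _)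
  have hne : ∀ i ≤ ℓ, ∀ j ≤ ℓ, S i ≠ S j → s(a i, b i) ≠ s(a j, b j) := fun i hi j hj hij h =>
    hij (hWF.injOn_delta (hmem i hi) (hmem j hj)
      (by rw [(hedge i hi).2.2.2, (hedge j hj).2.2.2, h]))
  obtain ⟨he, ha1, hb1, -⟩ := hedge 1 hℓ
  obtain ⟨C, hC, haC⟩ := haU
  have ha0 : a 1 ∉ S 0 := fun h =>
    hne 1 hℓ 0 (Nat.zero_le _) h01.2.1.ne'
      (eq_of_delta_eq_singleton (hedge 0 (Nat.zero_le _)).2.2.2 he h fun h' => hb1 (h01.2.1.le h'))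
  have hC1 : ¬ C ⊆ S 1 := fun h =>
    ha0 (Core.subset_of_uniqueChild hF hlam' hS1 h01 hC h haC)
  have hC2 : ¬ C ⊆ S 2 := fun h =>
    hC1 (Core.subset_of_uniqueChild hF hlam' hS2 h12 hC h)
  have hbC : b 1 ∉ C := by
    intro hbC
    obtain ⟨D, hD, u, v, huv, hu, hv⟩ := hcov _ he
    rcases Sym2.eq_iff.mp huv with ⟨rfl, rfl⟩ | ⟨rfl, rfl⟩
    · exact hv (hC.eq_of_mem hp hD haC hu ▸ hbC)
    · exact hv (hC.eq_of_mem hp hD hbC hu ▸ haC)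
  have hb2 : b 1 ∈ S 2 := by
    by_contra h
    exact hne 1 hℓ 2 hℓ2 h12.2.1.ne
      (eq_of_delta_eq_singleton (hedge 2 hℓ2).2.2.2 he (h12.2.1.le ha1) h)
  have hdiff : b 1 ∈ S 2 \ (S 1 ∪ C) := ⟨hb2, fun h => h.elim hb1 hbC⟩
  have hγ' := hγ ∅ (S 1) (S 2) C
  rw [residual_empty] at hγ'
  rcases hγ' (hWF.1 (hmem 1 hℓ)) (hWF.1 (hmem 2 hℓ2)) h12.2.1 hC
    (hC.crosses hF hp (hWF.1 (hmem 1 hℓ)) ⟨a 1, haC, ha1⟩ hC1)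
    (hC.crosses hF hp (hWF.1 (hmem 2 hℓ2)) ⟨a 1, haC, h12.2.1.le ha1⟩ hC2) with h | h
  · exact Set.notMem_empty _ (h ▸ hdiff)
  · obtain ⟨D, hD, hDS⟩ := exists_core_subset h
    have hD1 := Core.subset_of_uniqueChild hF hlam' hS2 h12 hD (hDS.trans Set.sdiff_subset)
    obtain ⟨x, hx⟩ : D.Nonempty := Set.nonempty_iff_ne_empty.mpr fun h => hF.1 (h ▸ hD.1)
    exact (hDS hx).2 (Or.inl (hD1 hx))
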